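/- The lattice II_{1,9} has exactly one orbit of primitive vectors of norm 0 under its automorphism group: for any two nonzero vectors u, v ∈ ℤ^{10} that are both primitive and isotropic (uᵀ G₁ u = vᵀ G₁ v = 0), there exists an integer matrix M with Mᵀ G₁ M = G₁ and M u = v. -/

import Mathlib

open Matrix

/-- The Gram (Cartan) matrix of the root lattice `E₈`. -/
def E8Gram : Matrix (Fin 8) (Fin 8) ℤ :=
  !![ 2,  0, -1,  0,  0,  0,  0,  0;
      0,  2,  0, -1,  0,  0,  0,  0;
     -1,  0,  2, -1,  0,  0,  0,  0;
      0, -1, -1,  2, -1,  0,  0,  0;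
      0,  0,  0, -1,  2, -1,  0,  0;
      0,  0,  0,  0, -1,  2, -1,  0;
      0,  0,  0,  0,  0, -1,  2, -1;
      0,  0,  0,  0,  0,  0, -1,  2]

/-- The Gram matrix of the even unimodular Lorentzian lattice `II_{1,8n+1}`,
the block-diagonal sum of `U = [[0,1],[1,0]]` and `n` copies of `-E₈`. -/
def IIGram (n : ℕ) : Matrix (Fin (8 * n + 2)) (Fin (8 * n + 2)) ℤ := fun i j =>
  if (i : ℕ) = 0 ∧ (j : ℕ) = 1 then 1
  else if (i : ℕ) = 1 ∧ (j : ℕ) = 0 then 1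
  else if 2 ≤ (i : ℕ) ∧ 2 ≤ (j : ℕ) ∧ ((i : ℕ) - 2) / 8 = ((j : ℕ) - 2) / 8 then
    -(E8Gram ⟨((i : ℕ) - 2) % 8, Nat.mod_lt _ (by norm_num)⟩
             ⟨((j : ℕ) - 2) % 8, Nat.mod_lt _ (by norm_num)⟩)
  else 0

open Finset in
/-- Every point of `ℝ⁸` with rational coordinates `wᵢ / (2b)` lies at squared distance less than
`2` from a point of the lattice `E₈ = D₈⁺`, whose elements are written here as `z / 2`. -/
theorem exists_D8plus_near (w : Fin 8 → ℤ) {b : ℤ} (hb : b ≠ 0) :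
    ∃ z : Fin 8 → ℤ, (∀ i j, (2 : ℤ) ∣ z i - z j) ∧ (4 : ℤ) ∣ ∑ i, z i ∧
      ∑ i, (w i - b * z i) ^ 2 < 8 * b ^ 2 := by
  have hround : ∀ a : ℤ, ∃ n : ℤ, |a - 2 * b * n| ≤ |b| := by
    intro a
    refine ⟨(a + |b|) / (2 * b), ?_⟩
    have h0 : 2 * b ≠ 0 := by simpa using hb
    have h1 := Int.emod_add_mul_ediv (a + |b|) (2 * b)
    have h2 := Int.emod_nonneg (a + |b|) h0
    have h3 := Int.emod_lt_abs (a + |b|) h0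
    rw [abs_mul, abs_two] at h3
    rw [abs_le]
    constructor <;> linarith
  choose n hn using fun i => hround (w i)
  have hb2 : 0 < |b| := abs_pos.2 hb
  have hsq : ∀ i, (w i - 2 * b * n i) ^ 2 ≤ b ^ 2 := fun i => sq_le_sq.2 (hn i)
  by_cases hall : ∀ i, |w i - 2 * b * n i| = |b|
  · have hz : ∀ i, ∃ z, w i = b * z ∧ ¬ (2 : ℤ) ∣ z := by
      intro i
      rcases abs_eq_abs.1 (hall i) with h | h
      · exact ⟨2 * n i + 1, by linear_combination h, by omega⟩
      · exact ⟨2 * n i - 1, by linear_combination h, by omega⟩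
    choose z hwz hodd using hz
    have hpar : (2 : ℤ) ∣ ∑ i, z i := by
      simp only [Fin.sum_univ_eight]
      have h0 := hodd 0
      have h1 := hodd 1
      have h2 := hodd 2
      have h3 := hodd 3
      have h4 := hodd 4
      have h5 := hodd 5
      have h6 := hodd 6
      have h7 := hodd 7
      omega
    by_cases h4 : (4 : ℤ) ∣ ∑ i, z i
    · refine ⟨z, fun i j => ?_, h4, ?_⟩
      · have := hodd i
        have := hodd j
        omega
      · simp only [hwz, sub_self]
        have := pow_pos hb2 2
        rw [sq_abs] at this
        simpa using this
    · refine ⟨z + Pi.single 0 2, fun i j => ?_, ?_, ?_⟩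
      · have hs : ∀ k, (2 : ℤ) ∣ (Pi.single 0 2 : Fin 8 → ℤ) k := by
          intro k
          rcases eq_or_ne k 0 with rfl | hk <;> simp [*]
        have := hodd i
        have := hodd j
        have := hs i
        have := hs j
        simp only [Pi.add_apply]
        omega
      · simp only [Pi.add_apply, sum_add_distrib, Fintype.sum_pi_single']
        omega
      · have : ∀ i, (w i - b * (z + Pi.single 0 2 : Fin 8 → ℤ) i) ^ 2
            = (Pi.single 0 (4 * b ^ 2) : Fin 8 → ℤ) i := by
          intro i
          rcases eq_or_ne i 0 with rfl | hk
          · simp [hwz]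
            ring
          · simp [hwz, hk]
        simp only [this, Fintype.sum_pi_single']
        have := pow_pos hb2 2
        rw [sq_abs] at this
        linarith
  · push Not at hall
    obtain ⟨j, hj⟩ := hall
    have hlt : ∑ i, (w i - 2 * b * n i) ^ 2 < 8 * b ^ 2 := by
      calc ∑ i, (w i - 2 * b * n i) ^ 2 < ∑ _i : Fin 8, b ^ 2 :=
            sum_lt_sum (fun i _ => hsq i)
              ⟨j, mem_univ _, sq_lt_sq.2 (lt_of_le_of_ne (hn j) hj)⟩
        _ = 8 * b ^ 2 := by simp
    by_cases hpar : (2 : ℤ) ∣ ∑ i, n i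
    · refine ⟨fun i => 2 * n i, fun i j => ⟨n i - n j, by ring⟩, ?_, ?_⟩
      · rw [← mul_sum]
        omega
      · convert hlt using 4
        ring
    · obtain ⟨k, -, hk⟩ := exists_max_image univ (fun i => |w i - 2 * b * n i|) univ_nonempty
      obtain ⟨e, he, her⟩ : ∃ e : ℤ, (e = 1 ∨ e = -1) ∧
          b * e * (w k - 2 * b * n k) = |b| * |w k - 2 * b * n k| := by
        rw [← abs_mul]
        rcases abs_choice (b * (w k - 2 * b * n k)) with h | h
        · exact ⟨1, by simp, by rw [h]; ring⟩
        · exact ⟨-1, by simp, by rw [h]; ring⟩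
      have he2 : e ^ 2 = 1 := by rcases he with rfl | rfl <;> rfl
      refine ⟨fun i => 2 * (n + Pi.single k e : Fin 8 → ℤ) i,
        fun i j => ⟨_, (mul_sub _ _ _).symm⟩, ?_, ?_⟩
      · rw [← mul_sum]
        simp only [Pi.add_apply, sum_add_distrib, Fintype.sum_pi_single']
        omega
      · have hle : ∑ i, (w i - 2 * b * n i) ^ 2 ≤ 8 * |w k - 2 * b * n k| ^ 2 := by
          calc _ ≤ ∑ _i : Fin 8, |w k - 2 * b * n k| ^ 2 :=
                sum_le_sum fun i _ => sq_le_sq.2 (by simpa using hk i (mem_univ _))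
            _ = _ := by simp
        have hterm : ∀ i, (w i - b * (2 * (n + Pi.single k e : Fin 8 → ℤ) i)) ^ 2
            = (w i - 2 * b * n i) ^ 2
              + (Pi.single k (4 * b ^ 2 - 4 * (|b| * |w k - 2 * b * n k|)) : Fin 8 → ℤ) i := by
          intro i
          rcases eq_or_ne i k with rfl | hik
          · simp only [Pi.add_apply, Pi.single_eq_same]
            linear_combination 4 * b ^ 2 * he2 - 4 * her
          · simp only [Pi.add_apply, Pi.single_eq_of_ne hik]
            ring
        simp only [hterm, sum_add_distrib, Fintype.sum_pi_single']
        rw [← sq_abs b] at hlt ⊢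
        have h0 := abs_nonneg (w k - 2 * b * n k)
        rcases (hn k).lt_or_eq with h | h
        · nlinarith
        · rw [h] at hle ⊢
          linarith

theorem E8Gram_isSymm : E8Gram.IsSymm := by
  unfold Matrix.IsSymm
  decide

/-- Twice the orthonormal coordinates of the vector of `E₈` with coordinates `x` in the basis of
simple roots. -/
def E8Coord (x : Fin 8 → ℤ) : Fin 8 → ℤ :=
  ![x 0 + 2 * x 1 - 2 * x 2, -x 0 + 2 * x 1 + 2 * x 2 - 2 * x 3, -x 0 + 2 * x 3 - 2 * x 4,
    -x 0 + 2 * x 4 - 2 * x 5, -x 0 + 2 * x 5 - 2 * x 6, -x 0 + 2 * x 6 - 2 * x 7,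
    -x 0 + 2 * x 7, x 0]

theorem four_mul_E8Gram_form (x : Fin 8 → ℤ) :
    4 * (x ⬝ᵥ E8Gram *ᵥ x) = ∑ i, E8Coord x i ^ 2 := by
  simp [dotProduct, mulVec, Fin.sum_univ_eight, E8Coord, E8Gram]
  ring

theorem E8Coord_sub_smul (x y : Fin 8 → ℤ) (b : ℤ) (i : Fin 8) :
    E8Coord (x - b • y) i = E8Coord x i - b * E8Coord y i := by
  fin_cases i <;> simp [E8Coord] <;> ring

theorem exists_E8Coord_eq {z : Fin 8 → ℤ} (hpar : ∀ i j, (2 : ℤ) ∣ z i - z j)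
    (hsum : (4 : ℤ) ∣ ∑ i, z i) : ∃ x, E8Coord x = z := by
  have hc : ∀ i, ∃ c, z i + z 7 = 2 * c := fun i => by
    have := hpar i 7
    exact ⟨(z i + z 7) / 2, by omega⟩
  choose c hc using hc
  rw [Fin.sum_univ_eight] at hsum
  obtain ⟨d, hd⟩ := hsum
  have h0 := hc 0
  have h1 := hc 1
  have h2 := hc 2
  have h3 := hc 3
  have h4 := hc 4
  have h5 := hc 5
  have h6 := hc 6
  refine ⟨![z 7, d + z 7, d + 2 * z 7 - c 0, c 2 + c 3 + c 4 + c 5 + c 6,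
    c 3 + c 4 + c 5 + c 6, c 4 + c 5 + c 6, c 5 + c 6, c 6], ?_⟩
  ext i
  fin_cases i <;> simp [E8Coord] <;> linarith

theorem eq_zero_of_E8Gram_form_eq_zero {x : Fin 8 → ℤ} (h : x ⬝ᵥ E8Gram *ᵥ x = 0) : x = 0 := by
  have h4 := four_mul_E8Gram_form x
  rw [h, mul_zero, eq_comm, Finset.sum_eq_zero_iff_of_nonneg fun i _ => sq_nonneg _] at h4
  have hw : ∀ i, E8Coord x i = 0 := fun i => by simpa using h4 i (Finset.mem_univ i)
  simp [Fin.forall_fin_succ, E8Coord] at hw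
  ext i
  fin_cases i <;> simp <;> omega

theorem E8Gram_form_even (x : Fin 8 → ℤ) : ∃ q, x ⬝ᵥ E8Gram *ᵥ x = 2 * q := by
  refine ⟨x 0 ^ 2 + x 1 ^ 2 + x 2 ^ 2 + x 3 ^ 2 + x 4 ^ 2 + x 5 ^ 2 + x 6 ^ 2 + x 7 ^ 2 - x 0 * x 2
    - x 1 * x 3 - x 2 * x 3 - x 3 * x 4 - x 4 * x 5 - x 5 * x 6 - x 6 * x 7, ?_⟩
  simp [dotProduct, mulVec, Fin.sum_univ_eight, E8Gram]
  ring

/-- The covering radius of `E₈` is less than `√2`. -/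
theorem exists_E8Gram_form_sub_lt (x : Fin 8 → ℤ) {b : ℤ} (hb : b ≠ 0) :
    ∃ l : Fin 8 → ℤ, (x - b • l) ⬝ᵥ E8Gram *ᵥ (x - b • l) < 2 * b ^ 2 := by
  obtain ⟨z, hpar, hsum, hlt⟩ := exists_D8plus_near (E8Coord x) hb
  obtain ⟨l, rfl⟩ := exists_E8Coord_eq hpar hsum
  refine ⟨l, ?_⟩
  have := four_mul_E8Gram_form (x - b • l)
  simp only [E8Coord_sub_smul] at this
  linarith

/-- The `E₈`-component of a vector of `II_{1,9}`. -/
def E8Part (u : Fin (8 * 1 + 2) → ℤ) : Fin 8 → ℤ := fun i => u i.succ.succ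

theorem IIGram_one_form (u v : Fin (8 * 1 + 2) → ℤ) :
    u ⬝ᵥ IIGram 1 *ᵥ v = u 0 * v 1 + u 1 * v 0 - E8Part u ⬝ᵥ E8Gram *ᵥ E8Part v := by
  have hG : ∀ i j : Fin 8, IIGram 1 i.succ.succ j.succ.succ = -E8Gram i j := by decide
  have hG0 : ∀ i : Fin 8, IIGram 1 0 i.succ.succ = 0 ∧ IIGram 1 1 i.succ.succ = 0 ∧
      IIGram 1 i.succ.succ 0 = 0 ∧ IIGram 1 i.succ.succ 1 = 0 := by decide
  have hU : IIGram 1 0 0 = 0 ∧ IIGram 1 0 1 = 1 ∧ IIGram 1 1 0 = 1 ∧ IIGram 1 1 1 = 0 := by decide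
  have hs : ∀ f : Fin (8 * 1 + 2) → ℤ, ∑ i, f i = f 0 + f 1 + ∑ i : Fin 8, f i.succ.succ := by
    intro f
    exact (Fin.sum_univ_succ f).trans
      ((congrArg _ (Fin.sum_univ_succ fun i => f i.succ)).trans (add_assoc _ _ _).symm)
  simp only [dotProduct, mulVec, hs, hG, hG0, hU, E8Part]
  simp [Finset.mul_sum]
  ring

/-- Two vectors of `II_{1,9}` are related if an automorphism maps the first to the second. -/
def SameOrbit (u v : Fin (8 * 1 + 2) → ℤ) : Prop :=
  ∃ M : Matrix (Fin (8 * 1 + 2)) (Fin (8 * 1 + 2)) ℤ,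
    Mᵀ * IIGram 1 * M = IIGram 1 ∧ M *ᵥ u = v

theorem SameOrbit.trans {u v w : Fin (8 * 1 + 2) → ℤ} :
    SameOrbit u v → SameOrbit v w → SameOrbit u w := by
  rintro ⟨M, hM, rfl⟩ ⟨N, hN, rfl⟩
  refine ⟨N * M, ?_, by rw [mulVec_mulVec]⟩
  calc (N * M)ᵀ * IIGram 1 * (N * M) = Mᵀ * (Nᵀ * IIGram 1 * N) * M := by
        simp only [transpose_mul, Matrix.mul_assoc]
    _ = IIGram 1 := by rw [hN, hM]

theorem exists_mul_IIGram_one_eq_one :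
    ∃ K : Matrix (Fin (8 * 1 + 2)) (Fin (8 * 1 + 2)) ℤ, K * IIGram 1 = 1 := by
  refine ⟨!![0, 1, 0, 0, 0, 0, 0, 0, 0, 0;
    1, 0, 0, 0, 0, 0, 0, 0, 0, 0;
    0, 0, -4, -5, -7, -10, -8, -6, -4, -2;
    0, 0, -5, -8, -10, -15, -12, -9, -6, -3;
    0, 0, -7, -10, -14, -20, -16, -12, -8, -4;
    0, 0, -10, -15, -20, -30, -24, -18, -12, -6;
    0, 0, -8, -12, -16, -24, -20, -15, -10, -5;
    0, 0, -6, -9, -12, -18, -15, -12, -8, -4;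
    0, 0, -4, -6, -8, -12, -10, -8, -6, -3;
    0, 0, -2, -3, -4, -6, -5, -4, -3, -2], ?_⟩
  decide +kernel

theorem SameOrbit.symm {u v : Fin (8 * 1 + 2) → ℤ} : SameOrbit u v → SameOrbit v u := by
  rintro ⟨M, hM, rfl⟩
  obtain ⟨K, hK⟩ := exists_mul_IIGram_one_eq_one
  have h1 : K * Mᵀ * IIGram 1 * M = 1 := by
    rw [← hK]
    nth_rw 2 [← hM]
    simp only [Matrix.mul_assoc]
  have h2 : M * (K * Mᵀ * IIGram 1) = 1 := mul_eq_one_comm.1 h1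
  refine ⟨K * Mᵀ * IIGram 1, ?_, by rw [mulVec_mulVec, h1, one_mulVec]⟩
  generalize K * Mᵀ * IIGram 1 = N at h2
  calc Nᵀ * IIGram 1 * N = (M * N)ᵀ * IIGram 1 * (M * N) := by
        nth_rw 1 [← hM]
        simp only [transpose_mul, Matrix.mul_assoc]
    _ = IIGram 1 := by rw [h2]; simp

theorem sameOrbit_of_form_eq (f : (Fin (8 * 1 + 2) → ℤ) →ₗ[ℤ] (Fin (8 * 1 + 2) → ℤ))
    (hf : ∀ u v, f u ⬝ᵥ IIGram 1 *ᵥ f v = u ⬝ᵥ IIGram 1 *ᵥ v) (u : Fin (8 * 1 + 2) → ℤ) :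
    SameOrbit u (f u) := by
  refine ⟨LinearMap.toMatrix' f, ?_, LinearMap.toMatrix'_mulVec f u⟩
  ext i j
  have hentry : ∀ A : Matrix (Fin (8 * 1 + 2)) (Fin (8 * 1 + 2)) ℤ,
      A i j = Pi.single i 1 ⬝ᵥ A *ᵥ Pi.single j 1 := by simp
  rw [hentry (_ * _), hentry (IIGram 1), ← hf, ← mulVec_mulVec, ← mulVec_mulVec, dotProduct_mulVec,
    vecMul_transpose, LinearMap.toMatrix'_mulVec, LinearMap.toMatrix'_mulVec]

/-- The Eichler transvection attached to `l`, followed by the exchange of the two isotropic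
basis vectors of the hyperbolic plane. -/
def swapTransvection (l : Fin 8 → ℤ) (q : ℤ) :
    (Fin (8 * 1 + 2) → ℤ) →ₗ[ℤ] (Fin (8 * 1 + 2) → ℤ) where
  toFun u := Fin.cons (u 1) (Fin.cons (u 0 - l ⬝ᵥ E8Gram *ᵥ E8Part u + q * u 1)
    (E8Part u - u 1 • l))
  map_add' u v := by
    have hE : E8Part (u + v) = E8Part u + E8Part v := rfl
    ext i
    refine Fin.cases rfl (fun i => Fin.cases ?_ (fun i => ?_) i) i
    · simp [hE, mulVec_add]
      ring
    · simp [hE]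
      ring
  map_smul' c u := by
    have hE : E8Part (c • u) = c • E8Part u := rfl
    ext i
    refine Fin.cases rfl (fun i => Fin.cases ?_ (fun i => ?_) i) i
    · simp only [hE, mulVec_smul, dotProduct_smul, smul_eq_mul, Pi.smul_apply, Fin.cons_succ,
        Fin.cons_zero, RingHom.id_apply]
      ring
    · simp only [hE, smul_eq_mul, Pi.smul_apply, Pi.sub_apply, Fin.cons_succ, RingHom.id_apply]
      ring

theorem IIGram_one_form_swapTransvection {l : Fin 8 → ℤ} {q : ℤ}
    (hq : l ⬝ᵥ E8Gram *ᵥ l = 2 * q) (u v : Fin (8 * 1 + 2) → ℤ) :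
    swapTransvection l q u ⬝ᵥ IIGram 1 *ᵥ swapTransvection l q v = u ⬝ᵥ IIGram 1 *ᵥ v := by
  have h0 : ∀ u, swapTransvection l q u 0 = u 1 := fun u => rfl
  have h1 : ∀ u, swapTransvection l q u 1 = u 0 - l ⬝ᵥ E8Gram *ᵥ E8Part u + q * u 1 :=
    fun u => rfl
  have h2 : ∀ u, E8Part (swapTransvection l q u) = E8Part u - u 1 • l := fun u => rfl
  have hsymm : E8Part u ⬝ᵥ E8Gram *ᵥ l = l ⬝ᵥ E8Gram *ᵥ E8Part u := by
    rw [dotProduct_mulVec, ← mulVec_transpose, E8Gram_isSymm, dotProduct_comm]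
  simp only [IIGram_one_form, h0, h1, h2, sub_dotProduct, mulVec_sub, dotProduct_sub, mulVec_smul,
    smul_dotProduct, dotProduct_smul, smul_eq_mul, hq, hsymm]
  ring

theorem exists_sameOrbit_single (u : Fin (8 * 1 + 2) → ℤ) (hu : u ⬝ᵥ IIGram 1 *ᵥ u = 0) :
    ∃ c : ℤ, SameOrbit u (c • Pi.single 0 1) := by
  induction hk : (u 1).natAbs using Nat.strong_induction_on generalizing u with
  | _ k ih =>
    rcases eq_or_ne (u 1) 0 with hb | hb
    · refine ⟨u 0, 1, by simp, ?_⟩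
      rw [IIGram_one_form, hb] at hu
      have hx := eq_zero_of_E8Gram_form_eq_zero (x := E8Part u) (by linarith)
      rw [one_mulVec]
      ext i
      refine Fin.cases (by simp) (fun i => Fin.cases ?_ (fun i => ?_) i) i
      · simpa using hb
      · simpa [E8Part] using congrFun hx i
    · obtain ⟨l, hl⟩ := exists_E8Gram_form_sub_lt (E8Part u) hb
      obtain ⟨q, hq⟩ := E8Gram_form_even l
      have hform := IIGram_one_form_swapTransvection hq
      have hv := hform u u
      rw [hu] at hv
      have horb := sameOrbit_of_form_eq _ hform u
      have hv' := hv
      rw [IIGram_one_form] at hv'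
      have h0 : swapTransvection l q u 0 = u 1 := rfl
      have h2 : E8Part (swapTransvection l q u) = E8Part u - u 1 • l := rfl
      rw [h0, h2] at hv'
      have hnn := four_mul_E8Gram_form (E8Part u - u 1 • l)
      have hnn' : 0 ≤ ∑ i, E8Coord (E8Part u - u 1 • l) i ^ 2 :=
        Finset.sum_nonneg fun i _ => sq_nonneg _
      have hlt : |swapTransvection l q u 1| < |u 1| := by
        have hpos : 0 < |u 1| := abs_pos.2 hb
        have hprod : |u 1| * |swapTransvection l q u 1| < |u 1| * |u 1| := by
          rw [← abs_mul, abs_of_nonneg (by linarith), abs_mul_abs_self]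
          linarith
        exact lt_of_mul_lt_mul_left hprod hpos.le
      obtain ⟨c, hc⟩ := ih _ (by rw [← hk]; zify; exact hlt) _ hv rfl
      exact ⟨c, horb.trans hc⟩

theorem sameOrbit_single_of_primitive {u : Fin (8 * 1 + 2) → ℤ}
    (hprim : Finset.univ.gcd u = 1) (hu : u ⬝ᵥ IIGram 1 *ᵥ u = 0) :
    SameOrbit u (Pi.single 0 1) := by
  obtain ⟨c, hc⟩ := exists_sameOrbit_single u hu
  obtain ⟨N, -, hN⟩ := hc.symm
  have hdvd : c ∣ 1 := by
    rw [← hprim]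
    refine Finset.dvd_gcd fun i _ => ?_
    rw [← hN, mulVec_smul]
    exact ⟨_, rfl⟩
  rcases Int.isUnit_iff.1 (isUnit_of_dvd_one hdvd) with rfl | rfl
  · simpa using hc
  · exact hc.trans ⟨-1, by simp, by rw [neg_mulVec, one_mulVec, neg_smul, one_smul, neg_neg]⟩

/-- The lattice `II_{1,9}` (the case `n = 1`, with Gram matrix `G₁ = U ⊕ (-E₈)`,
a `10 × 10` matrix) has exactly one orbit of primitive norm-zero vectors under
its automorphism group. -/
theorem II19_single_orbit_primitive_isotropic
    (u v : Fin (8 * 1 + 2) → ℤ) (hu0 : u ≠ 0) (hv0 : v ≠ 0)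
    (hu_prim : Finset.univ.gcd u = 1) (hv_prim : Finset.univ.gcd v = 1)
    (hu_norm : u ⬝ᵥ (IIGram 1).mulVec u = 0)
    (hv_norm : v ⬝ᵥ (IIGram 1).mulVec v = 0) :
    ∃ M : Matrix (Fin (8 * 1 + 2)) (Fin (8 * 1 + 2)) ℤ,
      Mᵀ * IIGram 1 * M = IIGram 1 ∧ M.mulVec u = v :=
  (sameOrbit_single_of_primitive hu_prim hu_norm).trans
    (sameOrbit_single_of_primitive hv_prim hv_norm).symm
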